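/- Let K_4 be the kernel of the group homomorphism B_4 → B_3 determined by σ_1 ↦ σ_1, σ_2 ↦ σ_2, σ_3 ↦ σ_1 (a subgroup of B'_4). If φ is an automorphism of B'_4 such that φ(x) = x for every x ∈ K_4, then φ is the identity automorphism of B'_4. -/

import Mathlib

/-- Relators of the Artin presentation of the braid group on `n` strings:
generators `σ_0, …, σ_{n-2}` (0-based), with `σ_i σ_j = σ_j σ_i` for `|i-j| > 1`
and `σ_i σ_j σ_i = σ_j σ_i σ_j` for `|i-j| = 1`. -/
def braidRels (n : ℕ) : Set (FreeGroup (Fin (n - 1))) :=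
  {r | (∃ i j : Fin (n - 1), (i : ℕ) + 2 ≤ (j : ℕ) ∧
          r = FreeGroup.of i * FreeGroup.of j * (FreeGroup.of i)⁻¹ * (FreeGroup.of j)⁻¹) ∨
       (∃ i j : Fin (n - 1), (j : ℕ) = (i : ℕ) + 1 ∧
          r = FreeGroup.of i * FreeGroup.of j * FreeGroup.of i *
              (FreeGroup.of j * FreeGroup.of i * FreeGroup.of j)⁻¹)}

/-- The braid group `B_n`, presented by Artin generators and relations. -/
abbrev BraidGroup (n : ℕ) := PresentedGroup (braidRels n)

/-- The Artin generator `σ_{i+1}` (1-based), i.e. `σ i` for `i : Fin (n-1)` (0-based). -/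
def σ {n : ℕ} (i : Fin (n - 1)) : BraidGroup n := PresentedGroup.of i

open SemidirectProduct Matrix MatrixGroups

section GroupIdentities

variable {G : Type*} [Group G] {x y z : G}

theorem inv_mul_mul_of_braid (h : x * y * x = y * x * y) : x⁻¹ * y * x = y * x * y⁻¹ := by
  rw [eq_mul_inv_iff_mul_eq, mul_assoc, mul_assoc, inv_mul_eq_iff_eq_mul]
  simpa [mul_assoc] using h.symm

theorem conj_conj_of_braid (hxy : x * y * x = y * x * y) (hyz : y * z * y = z * y * z) :
    x * (y * (z * x⁻¹) * y⁻¹) * x⁻¹ = (z * x⁻¹)⁻¹ * (y * (z * x⁻¹) * y⁻¹) := by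
  have h1 : x⁻¹ * y⁻¹ * x⁻¹ = y⁻¹ * x⁻¹ * y⁻¹ := by
    simpa [mul_assoc] using congrArg (·⁻¹) hxy
  have h2 : y * z * y⁻¹ = z⁻¹ * y * z := (inv_mul_mul_of_braid hyz.symm).symm
  calc x * (y * (z * x⁻¹) * y⁻¹) * x⁻¹ = x * (y * z) * (x⁻¹ * y⁻¹ * x⁻¹) := by group
    _ = x * (y * z * y⁻¹) * x⁻¹ * y⁻¹ := by rw [h1]; group
    _ = (x * z⁻¹) * y * z * x⁻¹ * y⁻¹ := by rw [h2]; simp only [mul_assoc]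
    _ = (z * x⁻¹)⁻¹ * (y * (z * x⁻¹) * y⁻¹) := by simp [mul_assoc]

theorem sq_conj_of_braid (hxy : x * y * x = y * x * y) (hyz : y * z * y = z * y * z)
    (hxz : x * z = z * x) :
    y * (y * (z * x⁻¹) * y⁻¹) * y⁻¹ =
      (y * (z * x⁻¹) * y⁻¹) * (z * x⁻¹)⁻¹ * (y * (z * x⁻¹) * y⁻¹) := by
  have h1 : x⁻¹ * y⁻¹ * x⁻¹ = y⁻¹ * x⁻¹ * y⁻¹ := by
    simpa [mul_assoc] using congrArg (·⁻¹) hxy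
  have h2 : z⁻¹ * y * z = y * z * y⁻¹ := inv_mul_mul_of_braid hyz.symm
  have h3 : x⁻¹ * y⁻¹ * x = y * x⁻¹ * y⁻¹ := by
    simpa [mul_assoc] using congrArg (·⁻¹) (inv_mul_mul_of_braid hxy)
  have h4 : x⁻¹ * z = z * x⁻¹ := (show Commute x z from hxz).inv_left.eq
  have key : y * (z * x⁻¹) * y⁻¹ =
      (z * x⁻¹) * (y⁻¹ * (z * x⁻¹)⁻¹ * y) * (z * x⁻¹) := by
    symm
    calc (z * x⁻¹) * (y⁻¹ * (z * x⁻¹)⁻¹ * y) * (z * x⁻¹)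
        = z * (x⁻¹ * y⁻¹ * x) * (z⁻¹ * y * z) * x⁻¹ := by group
      _ = z * y * (x⁻¹ * z) * y⁻¹ * x⁻¹ := by rw [h2, h3]; group
      _ = (z * y * z) * (x⁻¹ * y⁻¹ * x⁻¹) := by rw [h4]; group
      _ = y * (z * x⁻¹) * y⁻¹ := by rw [h1, ← hyz]; group
  nth_rewrite 1 [key]
  group

end GroupIdentities

section BraidThree

variable {G : Type*} [Group G]

/-- The homomorphism from `B_3` determined by a pair satisfying the braid relation. -/
def braidThreeLift (x y : G) (h : x * y * x = y * x * y) : BraidGroup 3 →* G :=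
  PresentedGroup.toGroup (f := (![x, y] : Fin (3 - 1) → G)) (by
    rintro r (⟨i, j, hij, rfl⟩ | ⟨i, j, hij, rfl⟩)
    · omega
    · obtain rfl : i = (0 : Fin 2) := by ext; simp; omega
      obtain rfl : j = (1 : Fin 2) := by ext; simpa using hij
      simp [h])

@[simp]
theorem braidThreeLift_zero (x y : G) (h : x * y * x = y * x * y) :
    braidThreeLift x y h (σ (0 : Fin 2)) = x := by
  simp [braidThreeLift, σ]

@[simp]
theorem braidThreeLift_one (x y : G) (h : x * y * x = y * x * y) :
    braidThreeLift x y h (σ (1 : Fin 2)) = y := by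
  simp [braidThreeLift, σ]

theorem BraidGroup.braid_rel {n : ℕ} (i j : Fin (n - 1)) (h : (j : ℕ) = i + 1) :
    (σ i * σ j * σ i : BraidGroup n) = σ j * σ i * σ j :=
  PresentedGroup.mk_eq_mk_of_mul_inv_mem (Or.inr ⟨i, j, h, rfl⟩)

theorem BraidGroup.comm_rel {n : ℕ} (i j : Fin (n - 1)) (h : (i : ℕ) + 2 ≤ j) :
    (σ i * σ j : BraidGroup n) = σ j * σ i :=
  PresentedGroup.mk_eq_mk_of_mul_inv_mem (Or.inl ⟨i, j, h, by group⟩)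

theorem BraidGroup.induction_three {p : BraidGroup 3 → Prop} (h1 : p 1)
    (hmul : ∀ x y, p x → p y → p (x * y)) (hinv : ∀ x, p x → p x⁻¹)
    (hσ0 : p (σ (0 : Fin 2))) (hσ1 : p (σ (1 : Fin 2))) (w : BraidGroup 3) : p w := by
  let H : Subgroup (BraidGroup 3) :=
    { carrier := {w | p w}
      one_mem' := h1
      mul_mem' := fun {x y} => hmul x y
      inv_mem' := fun {x} => hinv x }
  refine PresentedGroup.generated_by _ H (fun i => ?_) w
  change Fin 2 at i
  fin_cases i
  exacts [hσ0, hσ1]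

end BraidThree

section BraidFour

variable {G : Type*} [Group G]

/-- The homomorphism from `B_4` determined by a triple satisfying Artin's relations. -/
def braidFourLift (x y z : G) (hxy : x * y * x = y * x * y) (hyz : y * z * y = z * y * z)
    (hxz : x * z = z * x) : BraidGroup 4 →* G :=
  PresentedGroup.toGroup (f := (![x, y, z] : Fin (4 - 1) → G)) (by
    rintro r (⟨i, j, hij, rfl⟩ | ⟨i, j, hij, rfl⟩)
    · obtain rfl : i = (0 : Fin 3) := by ext; simp; omega
      obtain rfl : j = (2 : Fin 3) := by ext; simp; omega
      simp [hxz]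
    · change Fin 3 at i j
      have hi : i = 0 ∨ i = 1 := by omega
      obtain rfl | rfl := hi
      · obtain rfl : j = (1 : Fin 3) := by ext; simpa using hij
        simp [hxy]
      · obtain rfl : j = (2 : Fin 3) := by ext; simpa using hij
        simp [hyz])

variable (x y z : G) (hxy : x * y * x = y * x * y) (hyz : y * z * y = z * y * z)
    (hxz : x * z = z * x)

@[simp]
theorem braidFourLift_zero : braidFourLift x y z hxy hyz hxz (σ (0 : Fin 3)) = x := by
  simp [braidFourLift, σ]

@[simp]
theorem braidFourLift_one : braidFourLift x y z hxy hyz hxz (σ (1 : Fin 3)) = y := by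
  simp [braidFourLift, σ]

@[simp]
theorem braidFourLift_two : braidFourLift x y z hxy hyz hxz (σ (2 : Fin 3)) = z := by
  simp [braidFourLift, σ]

theorem BraidGroup.hom_ext_four {f g : BraidGroup 4 →* G}
    (h0 : f (σ (0 : Fin 3)) = g (σ (0 : Fin 3)))
    (h1 : f (σ (1 : Fin 3)) = g (σ (1 : Fin 3)))
    (h2 : f (σ (2 : Fin 3)) = g (σ (2 : Fin 3))) : f = g := by
  refine PresentedGroup.ext fun i => ?_
  change Fin 3 at i
  fin_cases i
  exacts [h0, h1, h2]

end BraidFour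

section PingPong

/-- The matrices `!![2, 1; 1, 1]` and `!![1, 1; 1, 2]`, free generators of the commutator subgroup
of `SL(2, ℤ)`. -/
def commGen : Fin 2 → SL(2, ℤ) :=
  ![⟨!![2, 1; 1, 1], by simp [det_fin_two]⟩, ⟨!![1, 1; 1, 2], by simp [det_fin_two]⟩]

theorem lift_commGen_injective : Function.Injective (FreeGroup.lift commGen) := by
  let P : Fin 2 → ℤ → ℤ → Prop :=
    ![fun x y => (0 < y ∧ y ≤ x) ∨ (y < 0 ∧ x ≤ y),
      fun x y => (0 < y ∧ 0 ≤ x ∧ x < y) ∨ (y < 0 ∧ x ≤ 0 ∧ y < x)]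
  let Q : Fin 2 → ℤ → ℤ → Prop :=
    ![fun x y => (0 < y ∧ x < 0 ∧ 0 ≤ x + y) ∨ (y < 0 ∧ 0 < x ∧ x + y ≤ 0),
      fun x y => y = 0 ∨ (0 < y ∧ x + y < 0) ∨ (y < 0 ∧ 0 < x + y)]
  have hne (g : SL(2, ℤ)) : g 0 0 ≠ 0 ∨ g 1 0 ≠ 0 := by
    by_contra! h
    have := g.det_coe
    rw [det_fin_two, h.1, h.2] at this
    simp at this
  have hmul (g h : SL(2, ℤ)) (i : Fin 2) :
      (g * h) i 0 = g i 0 * h 0 0 + g i 1 * h 1 0 := by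
    simp [Matrix.mul_apply]
  have hinv (i : Fin 2) : (commGen⁻¹ i : Matrix (Fin 2) (Fin 2) ℤ) =
      adjugate (commGen i : Matrix (Fin 2) (Fin 2) ℤ) := rfl
  have h0 : (commGen 0 : Matrix (Fin 2) (Fin 2) ℤ) = !![2, 1; 1, 1] := rfl
  have h1 : (commGen 1 : Matrix (Fin 2) (Fin 2) ℤ) = !![1, 1; 1, 2] := rfl
  refine FreeGroup.injective_lift_of_ping_pong commGen
    (fun i => {g : SL(2, ℤ) | P i (g 0 0) (g 1 0)})
    (fun i => {g : SL(2, ℤ) | Q i (g 0 0) (g 1 0)}) ?_ ?_ ?_ ?_ ?_ ?_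
  · rw [Fin.forall_fin_two]
    exact ⟨⟨⟨!![1, 0; 1, 1], by simp [det_fin_two]⟩, Or.inl (by decide)⟩,
      ⟨⟨!![0, -1; 1, 0], by simp [det_fin_two]⟩, Or.inl (by decide)⟩⟩
  · intro i j hij
    rw [Function.onFun, Set.disjoint_left]
    intro g
    fin_cases i <;> fin_cases j <;> simp [P] at hij ⊢ <;> omega
  · intro i j hij
    rw [Function.onFun, Set.disjoint_left]
    intro g
    have := hne g
    fin_cases i <;> fin_cases j <;> simp [Q] at hij ⊢ <;> omega
  · intro i j
    rw [Set.disjoint_left]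
    intro g
    have := hne g
    fin_cases i <;> fin_cases j <;> simp [P, Q] <;> omega
  · intro i
    rw [Set.smul_set_subset_iff]
    intro g (hg : ¬ Q i (g 0 0) (g 1 0))
    change P i ((commGen i * g) 0 0) ((commGen i * g) 1 0)
    have := hne g
    rw [hmul, hmul]
    fin_cases i
    · simp [P, Q, h0] at hg ⊢
      omega
    · simp [P, Q, h1] at hg ⊢
      omega
  · intro i
    rw [Set.smul_set_subset_iff]
    intro g (hg : ¬ P i (g 0 0) (g 1 0))
    change Q i ((commGen⁻¹ i * g) 0 0) ((commGen⁻¹ i * g) 1 0)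
    have := hne g
    rw [hmul, hmul, hinv, adjugate_fin_two]
    fin_cases i
    · simp [P, Q, h0] at hg ⊢
      omega
    · simp [P, Q, h1] at hg ⊢
      omega

end PingPong

section Burau

/-- The reduced Burau representation of `B_3` at `-1`, in the basis in which it describes the
action of `B_3` on the abelianization of the free group of rank two. -/
def burau : BraidGroup 3 →* SL(2, ℤ) :=
  braidThreeLift ⟨!![1, -1; 0, 1], by simp [det_fin_two]⟩ ⟨!![0, -1; 1, 2], by simp [det_fin_two]⟩
    (Subtype.ext (by decide))

/-- The exponent sum on `B_3`. -/
def exponentSum : BraidGroup 3 →* Multiplicative ℤ :=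
  braidThreeLift (.ofAdd 1) (.ofAdd 1) rfl

/-- Free generators of the commutator subgroup of `B_3`. -/
def braidCommGen : Fin 2 → BraidGroup 3 :=
  ![σ (1 : Fin 2) * σ (0 : Fin 2) * (σ (1 : Fin 2))⁻¹ * (σ (1 : Fin 2))⁻¹,
    (σ (0 : Fin 2))⁻¹ * σ (1 : Fin 2)]

theorem burau_comp_lift_braidCommGen :
    burau.comp (FreeGroup.lift braidCommGen) = FreeGroup.lift commGen := by
  refine FreeGroup.ext_hom _ _ fun i => ?_
  fin_cases i <;> simp [burau, braidCommGen, commGen] <;> exact Subtype.ext (by decide)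

theorem exponentSum_lift_braidCommGen (g : FreeGroup (Fin 2)) :
    exponentSum (FreeGroup.lift braidCommGen g) = 1 := by
  have : exponentSum.comp (FreeGroup.lift braidCommGen) = 1 := by
    ext i : 1
    fin_cases i <;> simp [exponentSum, braidCommGen]
  exact DFunLike.congr_fun this g

/-- Conjugation by `σ_1`, on the free group on `braidCommGen`. -/
def conjAut : MulAut (FreeGroup (Fin 2)) :=
  MonoidHom.toMulEquiv
    (FreeGroup.lift ![.of 1, (.of 0)⁻¹ * .of 1]) (FreeGroup.lift ![.of 0 * (.of 1)⁻¹, .of 0])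
    (by ext i; fin_cases i <;> simp) (by ext i; fin_cases i <;> simp)

theorem lift_braidCommGen_conjAut (g : FreeGroup (Fin 2)) :
    FreeGroup.lift braidCommGen (conjAut g) =
      σ (0 : Fin 2) * FreeGroup.lift braidCommGen g * (σ (0 : Fin 2))⁻¹ := by
  have hb := BraidGroup.braid_rel (n := 3) (0 : Fin 2) (1 : Fin 2) rfl
  have h1 := inv_mul_mul_of_braid hb
  have : (FreeGroup.lift braidCommGen).comp conjAut.toMonoidHom =
      (MulAut.conj (σ (0 : Fin 2) : BraidGroup 3)).toMonoidHom.comp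
        (FreeGroup.lift braidCommGen) := by
    ext i
    fin_cases i
    · suffices σ (0 : Fin 2) * (σ (1 : Fin 2) * σ (0 : Fin 2) * (σ (1 : Fin 2))⁻¹ *
          (σ (1 : Fin 2))⁻¹) * (σ (0 : Fin 2))⁻¹ =
          ((σ (0 : Fin 2))⁻¹ * σ (1 : Fin 2) : BraidGroup 3) by
        simpa [conjAut, braidCommGen] using this.symm
      rw [← mul_assoc, ← mul_assoc, ← mul_assoc, hb, mul_inv_cancel_right, ← h1,
        mul_inv_cancel_right]
    · suffices (σ (1 : Fin 2) * σ (0 : Fin 2) * (σ (1 : Fin 2))⁻¹ * (σ (1 : Fin 2))⁻¹)⁻¹ *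
          ((σ (0 : Fin 2))⁻¹ * σ (1 : Fin 2)) =
          (σ (0 : Fin 2) * ((σ (0 : Fin 2))⁻¹ * σ (1 : Fin 2)) * (σ (0 : Fin 2))⁻¹ :
            BraidGroup 3) by
        simpa [conjAut, braidCommGen] using this
      rw [mul_inv_cancel_left, inv_mul_eq_iff_eq_mul, ← mul_assoc, inv_mul_cancel_right, ← h1,
        mul_inv_cancel_right]
  exact DFunLike.congr_fun this g

theorem exists_eq_lift_braidCommGen_mul_zpow (w : BraidGroup 3) :
    ∃ (g : FreeGroup (Fin 2)) (n : ℤ), w = FreeGroup.lift braidCommGen g * σ (0 : Fin 2) ^ n := by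
  have hconj (n : ℤ) (g : FreeGroup (Fin 2)) : σ (0 : Fin 2) ^ n * FreeGroup.lift braidCommGen g =
      FreeGroup.lift braidCommGen ((conjAut ^ n) g) * σ (0 : Fin 2) ^ n := by
    induction n using Int.induction_on generalizing g with
    | zero => simp
    | succ n ih =>
      rw [_root_.zpow_add_one, mul_assoc, _root_.zpow_add_one, MulAut.mul_apply,
        ← mul_assoc _ (_ ^ _), ← ih, lift_braidCommGen_conjAut]
      group
    | pred n ih =>
      obtain ⟨g, rfl⟩ := conjAut.surjective g
      rw [_root_.zpow_sub_one, mul_assoc, _root_.zpow_sub_one, MulAut.mul_apply,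
        MulAut.inv_apply_self, ← mul_assoc _ (_ ^ _), ← ih, lift_braidCommGen_conjAut]
      group
  induction w using BraidGroup.induction_three with
  | h1 => exact ⟨1, 0, by simp⟩
  | hmul x y hx hy =>
    obtain ⟨g, n, rfl⟩ := hx
    obtain ⟨h, m, rfl⟩ := hy
    refine ⟨g * (conjAut ^ n) h, n + m, ?_⟩
    rw [map_mul, _root_.zpow_add, mul_assoc, ← mul_assoc _ _ (_ ^ m), hconj]
    simp only [mul_assoc]
  | hinv x hx =>
    obtain ⟨g, n, rfl⟩ := hx
    refine ⟨(conjAut ^ (-n)) g⁻¹, -n, ?_⟩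
    rw [← hconj]
    simp
  | hσ0 => exact ⟨1, 1, by simp⟩
  | hσ1 =>
    refine ⟨conjAut (.of 1), 1, ?_⟩
    rw [lift_braidCommGen_conjAut]
    simp [braidCommGen]

theorem eq_one_of_burau_eq_one {w : BraidGroup 3} (hw : burau w = 1) (he : exponentSum w = 1) :
    w = 1 := by
  obtain ⟨g, n, rfl⟩ := exists_eq_lift_braidCommGen_mul_zpow w
  have hn : n = 0 := by
    rw [map_mul, exponentSum_lift_braidCommGen, one_mul, map_zpow, exponentSum,
      braidThreeLift_zero] at he
    simpa using congrArg Multiplicative.toAdd he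
  subst hn
  rw [zpow_zero, mul_one] at hw ⊢
  have hg : FreeGroup.lift commGen g = 1 := by
    rw [← hw, ← burau_comp_lift_braidCommGen, MonoidHom.comp_apply]
  rw [(map_eq_one_iff _ lift_commGen_injective).mp hg, map_one]

end Burau

section SemidirectDecomposition

/-- The action of `σ_1` on the free group of rank two. -/
def freeAut₁ : MulAut (FreeGroup (Fin 2)) :=
  MonoidHom.toMulEquiv
    (FreeGroup.lift ![.of 0, (.of 0)⁻¹ * .of 1]) (FreeGroup.lift ![.of 0, .of 0 * .of 1])
    (by ext i; fin_cases i <;> simp) (by ext i; fin_cases i <;> simp)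

/-- The action of `σ_2` on the free group of rank two. -/
def freeAut₂ : MulAut (FreeGroup (Fin 2)) :=
  MonoidHom.toMulEquiv
    (FreeGroup.lift ![.of 1, .of 1 * (.of 0)⁻¹ * .of 1])
    (FreeGroup.lift ![.of 0 * (.of 1)⁻¹ * .of 0, .of 0])
    (by ext i; fin_cases i <;> simp [mul_assoc]) (by ext i; fin_cases i <;> simp [mul_assoc])

@[simp]
theorem freeAut₁_of_zero : freeAut₁ (.of 0) = .of 0 := by simp [freeAut₁]

@[simp]
theorem freeAut₁_of_one : freeAut₁ (.of 1) = (.of 0)⁻¹ * .of 1 := by simp [freeAut₁]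

@[simp]
theorem freeAut₂_of_zero : freeAut₂ (.of 0) = .of 1 := by simp [freeAut₂]

@[simp]
theorem freeAut₂_of_one : freeAut₂ (.of 1) = .of 1 * (.of 0)⁻¹ * .of 1 := by simp [freeAut₂]

/-- The action of `B_3` on the free group of rank two. -/
def braidAction : BraidGroup 3 →* MulAut (FreeGroup (Fin 2)) :=
  braidThreeLift freeAut₁ freeAut₂ (by
    refine MulEquiv.toMonoidHom_injective (FreeGroup.ext_hom _ _ fun i => ?_)
    fin_cases i <;> simp [MulAut.mul_apply, mul_assoc])

@[simp]
theorem braidAction_zero : braidAction (σ (0 : Fin 2)) = freeAut₁ := by simp [braidAction]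

@[simp]
theorem braidAction_one : braidAction (σ (1 : Fin 2)) = freeAut₂ := by simp [braidAction]

/-- The abelianization of the free group of rank two. -/
def freeAb : FreeGroup (Fin 2) →* Multiplicative (Fin 2 → ℤ) :=
  FreeGroup.lift fun i => .ofAdd (Pi.single i 1)

theorem freeAb_braidAction (w : BraidGroup 3) (k : FreeGroup (Fin 2)) :
    (freeAb (braidAction w k)).toAdd =
      (burau w : Matrix (Fin 2) (Fin 2) ℤ) *ᵥ (freeAb k).toAdd := by
  have hmul (x y : BraidGroup 3) : (burau (x * y) : Matrix (Fin 2) (Fin 2) ℤ) =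
      (burau x : Matrix (Fin 2) (Fin 2) ℤ) * (burau y : Matrix (Fin 2) (Fin 2) ℤ) := by
    rw [map_mul]
    rfl
  have hone : (burau 1 : Matrix (Fin 2) (Fin 2) ℤ) = 1 := by
    rw [map_one]
    rfl
  have h0 : (burau (σ (0 : Fin 2)) : Matrix (Fin 2) (Fin 2) ℤ) = !![1, -1; 0, 1] :=
    congrArg Subtype.val (braidThreeLift_zero (G := SL(2, ℤ)) _ _ _)
  have h1 : (burau (σ (1 : Fin 2)) : Matrix (Fin 2) (Fin 2) ℤ) = !![0, -1; 1, 2] :=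
    congrArg Subtype.val (braidThreeLift_one (G := SL(2, ℤ)) _ _ _)
  induction w using BraidGroup.induction_three generalizing k with
  | h1 => rw [hone, one_mulVec, map_one, MulAut.one_apply]
  | hmul x y hx hy => rw [map_mul, MulAut.mul_apply, hx, hy, hmul, mulVec_mulVec]
  | hinv x hx =>
    have := hx (braidAction x⁻¹ k)
    rw [← MulAut.mul_apply, ← map_mul, mul_inv_cancel, map_one, MulAut.one_apply] at this
    rw [this, mulVec_mulVec, ← hmul, inv_mul_cancel, hone, one_mulVec]
  | hσ0 =>
    rw [braidAction_zero, h0]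
    induction k using FreeGroup.induction_on with
    | C1 => simp
    | of i => fin_cases i <;> ext j <;> fin_cases j <;> simp [freeAb]
    | inv_of i h => simp only [map_inv, toAdd_inv, mulVec_neg, h]
    | mul x y hx hy => simp only [map_mul, toAdd_mul, mulVec_add, hx, hy]
  | hσ1 =>
    rw [braidAction_one, h1]
    induction k using FreeGroup.induction_on with
    | C1 => simp
    | of i => fin_cases i <;> ext j <;> fin_cases j <;> simp [freeAb]
    | inv_of i h => simp only [map_inv, toAdd_inv, mulVec_neg, h]
    | mul x y hx hy => simp only [map_mul, toAdd_mul, mulVec_add, hx, hy]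

/-- The homomorphism (in fact, isomorphism) from `B_4` to a semidirect product of a free group of
rank two and `B_3`. -/
def toSemidirect : BraidGroup 4 →* FreeGroup (Fin 2) ⋊[braidAction] BraidGroup 3 :=
  braidFourLift (inr (σ (0 : Fin 2))) (inr (σ (1 : Fin 2))) (inl (.of 0) * inr (σ (0 : Fin 2)))
    (by simp only [← map_mul, BraidGroup.braid_rel (n := 3) (0 : Fin 2) (1 : Fin 2) rfl])
    (by
      have := BraidGroup.braid_rel (n := 3) (0 : Fin 2) (1 : Fin 2) rfl
      ext <;> simp [MulAut.mul_apply, this])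
    (by ext <;> simp)

/-- The embedding of `B_3` into `B_4`. -/
def braidIncl : BraidGroup 3 →* BraidGroup 4 :=
  braidThreeLift (σ (0 : Fin 3)) (σ (1 : Fin 3)) (BraidGroup.braid_rel (n := 4) _ _ rfl)

/-- The free generators of the kernel of the homomorphism from `B_4` to `B_3`. -/
def kerGen : Fin 2 → BraidGroup 4 :=
  ![σ (2 : Fin 3) * (σ (0 : Fin 3))⁻¹,
    σ (1 : Fin 3) * (σ (2 : Fin 3) * (σ (0 : Fin 3))⁻¹) * (σ (1 : Fin 3))⁻¹]

theorem lift_kerGen_braidAction (w : BraidGroup 3) (k : FreeGroup (Fin 2)) :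
    FreeGroup.lift kerGen (braidAction w k) =
      braidIncl w * FreeGroup.lift kerGen k * (braidIncl w)⁻¹ := by
  have hxy := BraidGroup.braid_rel (n := 4) (0 : Fin 3) (1 : Fin 3) rfl
  have hyz := BraidGroup.braid_rel (n := 4) (1 : Fin 3) (2 : Fin 3) rfl
  have hxz := BraidGroup.comm_rel (n := 4) (0 : Fin 3) (2 : Fin 3) le_rfl
  induction w using BraidGroup.induction_three generalizing k with
  | h1 => simp
  | hmul x y hx hy => simp [MulAut.mul_apply, hx, hy, mul_assoc]
  | hinv x hx =>
    have := hx (braidAction x⁻¹ k)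
    rw [← MulAut.mul_apply, ← map_mul, mul_inv_cancel, map_one, MulAut.one_apply] at this
    rw [this]
    simp [mul_assoc]
  | hσ0 =>
    induction k using FreeGroup.induction_on with
    | C1 => simp
    | of i =>
      rw [braidAction_zero]
      fin_cases i
      · simp [kerGen, braidIncl, ← mul_assoc, hxz]
      · simpa [kerGen, braidIncl] using (conj_conj_of_braid hxy hyz).symm
    | inv_of i h => simp only [map_inv, h, conj_inv]
    | mul x y hx hy => simp only [map_mul, hx, hy, conj_mul]
  | hσ1 =>
    induction k using FreeGroup.induction_on with
    | C1 => simp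
    | of i =>
      rw [braidAction_one]
      fin_cases i
      · simp [kerGen, braidIncl]
      · simpa [kerGen, braidIncl] using (sq_conj_of_braid hxy hyz hxz).symm
    | inv_of i h => simp only [map_inv, h, conj_inv]
    | mul x y hx hy => simp only [map_mul, hx, hy, conj_mul]

/-- A left inverse of `toSemidirect`. -/
def ofSemidirect : FreeGroup (Fin 2) ⋊[braidAction] BraidGroup 3 →* BraidGroup 4 :=
  SemidirectProduct.lift (FreeGroup.lift kerGen) braidIncl
    fun w => MonoidHom.ext fun k => lift_kerGen_braidAction w k

theorem ofSemidirect_toSemidirect (x : BraidGroup 4) : ofSemidirect (toSemidirect x) = x := by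
  have : ofSemidirect.comp toSemidirect = MonoidHom.id _ := by
    apply BraidGroup.hom_ext_four <;> simp [ofSemidirect, toSemidirect, braidIncl, kerGen]
  exact DFunLike.congr_fun this x

theorem toSemidirect_lift_kerGen (k : FreeGroup (Fin 2)) :
    toSemidirect (FreeGroup.lift kerGen k) = inl k := by
  have : toSemidirect.comp (FreeGroup.lift kerGen) = inl := by
    refine FreeGroup.ext_hom _ _ fun i => ?_
    fin_cases i <;> ext <;> simp [toSemidirect, kerGen]
  exact DFunLike.congr_fun this k

theorem toSemidirect_injective : Function.Injective toSemidirect :=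
  Function.LeftInverse.injective ofSemidirect_toSemidirect

theorem kerGen_mem_commutator (i : Fin 2) : kerGen i ∈ commutator (BraidGroup 4) := by
  have h {x y : Abelianization (BraidGroup 4)} (h : x * y * x = y * x * y) : x = y := by
    rw [mul_comm y x] at h
    exact mul_left_cancel h
  have hσ (i j : Fin 3) (hij : (j : ℕ) = i + 1) :
      Abelianization.of (σ i : BraidGroup 4) = Abelianization.of (σ j) := by
    apply h
    simpa only [map_mul] using congrArg Abelianization.of (BraidGroup.braid_rel (n := 4) i j hij)
  have h1 := hσ 0 1 rfl
  have h2 := hσ 1 2 rfl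
  rw [← Abelianization.ker_of, MonoidHom.mem_ker]
  fin_cases i <;> simp [kerGen, ← h2, ← h1]

end SemidirectDecomposition

section Centralizer

theorem FreeGroup.eq_one_of_forall_commute {k : FreeGroup (Fin 2)} (h : ∀ g, Commute k g) :
    k = 1 := by
  have hc (i : Fin 2) : Commute (FreeGroup.lift commGen k) (commGen i) := by
    simpa using (h (.of i)).map (FreeGroup.lift commGen)
  set M := FreeGroup.lift commGen k with hM
  have hentry (i a b : Fin 2) : M a 0 * commGen i 0 b + M a 1 * commGen i 1 b =
      commGen i a 0 * M 0 b + commGen i a 1 * M 1 b := by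
    have := congrFun (congrFun (congrArg Subtype.val (hc i).eq) a) b
    change ((M : Matrix (Fin 2) (Fin 2) ℤ) * (commGen i : Matrix (Fin 2) (Fin 2) ℤ)) a b =
      ((commGen i : Matrix (Fin 2) (Fin 2) ℤ) * (M : Matrix (Fin 2) (Fin 2) ℤ)) a b at this
    simpa only [Matrix.mul_apply, Fin.sum_univ_two] using this
  have e1 : M 0 0 * 2 + M 0 1 * 1 = 2 * M 0 0 + 1 * M 1 0 := hentry 0 0 0
  have e2 : M 0 0 * 1 + M 0 1 * 1 = 2 * M 0 1 + 1 * M 1 1 := hentry 0 0 1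
  have e3 : M 0 0 * 1 + M 0 1 * 2 = 1 * M 0 1 + 1 * M 1 1 := hentry 1 0 1
  have h01 : M 0 1 = 0 := by omega
  have h10 : M 1 0 = 0 := by omega
  have h11 : M 1 1 = M 0 0 := by omega
  have hdet := M.det_coe
  rw [det_fin_two, h01, h10, h11, mul_zero, sub_zero] at hdet
  have hsq : M ^ 2 = 1 := by
    rw [sq]
    refine Matrix.SpecialLinearGroup.ext _ _ fun i j => ?_
    change ((M : Matrix (Fin 2) (Fin 2) ℤ) * (M : Matrix (Fin 2) (Fin 2) ℤ)) i j =
      (1 : Matrix (Fin 2) (Fin 2) ℤ) i j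
    rw [Matrix.mul_apply, Fin.sum_univ_two]
    fin_cases i <;> fin_cases j <;> simp [h01, h10, h11, hdet]
  rw [hM, ← map_pow, map_eq_one_iff _ lift_commGen_injective] at hsq
  exact (pow_eq_one_iff_left two_ne_zero).mp hsq

theorem eq_one_of_commute_kerGen {c : BraidGroup 4} (hc : c ∈ commutator (BraidGroup 4))
    (h : ∀ i, Commute c (kerGen i)) : c = 1 := by
  have hcomm (k : FreeGroup (Fin 2)) : Commute c (FreeGroup.lift kerGen k) := by
    induction k using FreeGroup.induction_on with
    | C1 => simp
    | of i => simpa using h i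
    | inv_of i h => simpa using h.inv_right
    | mul x y hx hy => simpa using hx.mul_right hy
  obtain ⟨k, w, hkw⟩ : ∃ k w, toSemidirect c = ⟨k, w⟩ := ⟨_, _, rfl⟩
  have hact (g : FreeGroup (Fin 2)) : k * braidAction w g = g * k := by
    have := (hcomm g).map toSemidirect
    rw [toSemidirect_lift_kerGen, hkw] at this
    simpa using congrArg SemidirectProduct.left this.eq
  have hw : w = 1 := by
    apply eq_one_of_burau_eq_one
    · have hab (g) : freeAb (braidAction w g) = freeAb g := by
        have := congrArg freeAb (hact g)
        rw [map_mul, map_mul, mul_comm] at this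
        exact mul_right_cancel this
      refine Subtype.ext (Matrix.ext fun i j => ?_)
      have := freeAb_braidAction w (.of j)
      rw [hab] at this
      simpa [freeAb, Pi.single_apply, Matrix.one_apply] using (congrFun this i).symm
    · have := Abelianization.commutator_subset_ker
        (exponentSum.comp (rightHom.comp toSemidirect)) hc
      simpa [MonoidHom.mem_ker, hkw] using this
  subst hw
  have hk : k = 1 := FreeGroup.eq_one_of_forall_commute fun g => by
    simpa using! hact g
  apply toSemidirect_injective
  rw [hkw, hk, map_one]
  rfl

end Centralizer

/-- Let `K_4` be the kernel of the homomorphism `B_4 → B_3` determined by `σ₁ ↦ σ₁`,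
`σ₂ ↦ σ₂`, `σ₃ ↦ σ₁` (a subgroup of `B'_4`). Every automorphism of `B'_4` fixing `K_4`
pointwise is the identity. -/
theorem aut_fixing_K4_is_id (f : BraidGroup 4 →* BraidGroup 3)
    (hf1 : f (σ ⟨0, by omega⟩) = σ ⟨0, by omega⟩)
    (hf2 : f (σ ⟨1, by omega⟩) = σ ⟨1, by omega⟩)
    (hf3 : f (σ ⟨2, by omega⟩) = σ ⟨0, by omega⟩)
    (φ : MulAut ↥(commutator (BraidGroup 4)))
    (hφ : ∀ x : ↥(commutator (BraidGroup 4)), (x : BraidGroup 4) ∈ f.ker → φ x = x) :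
    ∀ x : ↥(commutator (BraidGroup 4)), φ x = x := by
  have hker (i : Fin 2) : kerGen i ∈ f.ker := by
    rw [MonoidHom.mem_ker]
    change f (σ (0 : Fin 3)) = _ at hf1
    change f (σ (2 : Fin 3)) = _ at hf3
    fin_cases i <;> simp [kerGen, hf1, hf3]
  intro x
  suffices x⁻¹ * φ x = 1 from (inv_mul_eq_one.mp this).symm
  refine Subtype.ext (eq_one_of_commute_kerGen (x⁻¹ * φ x).2 fun i => ?_)
  let k : commutator (BraidGroup 4) := ⟨kerGen i, kerGen_mem_commutator i⟩
  have h1 : φ k = k := hφ k (hker i)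
  have h2 : φ (x * k * x⁻¹) = x * k * x⁻¹ :=
    hφ _ (f.normal_ker.conj_mem _ (hker i) _)
  rw [map_mul, map_mul, h1, map_inv] at h2
  have h3 : x⁻¹ * φ x * k = k * (x⁻¹ * φ x) := by
    rw [mul_inv_eq_iff_eq_mul] at h2
    rw [mul_assoc, h2]
    group
  exact congrArg Subtype.val h3
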